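/- arXiv:math/0105158 — 3 statements merged into one kernel-verified Lean document; each statement's English description precedes it below -/
import Mathlib

section
/- The extremal difference function is nonnegative: Δh(n) ≥ 0 for every integer n. -/
/-- The extremal difference function is nonnegative: `Δh n ≥ 0` for every integer `n`. -/
theorem stmt_3 (s d m ε w v k δ e : ℤ)
    (hs : 4 ≤ s)
    (hd : d - 1 = s * m + ε) (hε0 : 0 ≤ ε) (hε1 : ε ≤ s - 1)
    (hsw : s - 1 = 3 * w + v) (hv : v = 0 ∨ v = 1 ∨ v = 2) (hw : 1 ≤ w)
    (hcase0 : ε < w * (4 - v) → e = 0 ∧ ε = k * w + δ ∧ 0 ≤ δ ∧ δ < w)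
    (hcase1 : w * (4 - v) ≤ ε → e = 1 ∧ ε + 3 - v = k * (w + 1) + δ ∧ 0 ≤ δ ∧ δ < w + 1)
    (hm : w < m) (Δh : ℤ → ℤ)
    (hΔ : ∀ n : ℤ,
      (n < 0 → Δh n = 0) ∧
      (0 ≤ n ∧ n ≤ w → Δh n = 3 * n + 1) ∧
      (w < n ∧ n ≤ m → Δh n = s) ∧
      (m < n ∧ n ≤ m + δ → Δh n = s + k - 3 * (n - m)) ∧
      (m + δ < n ∧ n ≤ m + w + e → Δh n = s + k - 3 * (n - m) - 1) ∧
      (m + w + e < n → Δh n = 0)) :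
    ∀ n : ℤ, 0 ≤ Δh n := by
  intro n
  obtain ⟨h1, h2, h3, h4, h5, h6⟩ := hΔ n
  have key : 0 ≤ δ ∧ δ ≤ w + e ∧ 3 * e ≤ v + k := by
    rcases lt_or_ge ε (w * (4 - v)) with h | h
    · obtain ⟨he, hk, hδ0, hδ1⟩ := hcase0 h
      have : 0 ≤ k := by
        by_contra hneg
        have : k ≤ -1 := by omega
        nlinarith
      omega
    · obtain ⟨he, hk, hδ0, hδ1⟩ := hcase1 h
      have : 3 - v ≤ k := by
        by_contra hneg
        have : k ≤ 2 - v := by omega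
        nlinarith [mul_le_mul_of_nonneg_right this (by omega : 0 ≤ w + 1)]
      omega
  obtain ⟨a, b, c⟩ := key
  rcases lt_or_ge n 0 with g | g
  · rw [h1 g]
  rcases le_or_gt n w with g1 | g1
  · rw [h2 ⟨g, g1⟩]; omega
  rcases le_or_gt n m with g2 | g2
  · rw [h3 ⟨g1, g2⟩]; omega
  rcases le_or_gt n (m + δ) with g3 | g3
  · rw [h4 ⟨g2, g3⟩]; omega
  rcases le_or_gt n (m + w + e) with g4 | g4
  · rw [h5 ⟨g3, g4⟩]; omega
  · rw [h6 g4]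
end

section
/- The total sum of the extremal difference function equals the degree: Σ_{n = 0}^{m + w + e} Δh(n) = d. -/
theorem tele_aux (f G : ℤ → ℤ) (a b : ℤ) (ha : -1 ≤ a) (hab : a ≤ b)
    (h : ∀ n, a < n → n ≤ b → 2 * f n = G n - G (n - 1)) :
    2 * ∑ n ∈ Finset.Icc (0 : ℤ) b, f n
      = 2 * ∑ n ∈ Finset.Icc (0 : ℤ) a, f n + G b - G a := by
  induction b, hab using Int.le_induction with
  | base => ring
  | succ b hb ih =>
    have h1 := ih (fun n h1 h2 => h n h1 (by omega))
    have h2 := h (b + 1) (by omega) le_rfl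
    have h3 : Finset.Icc (0 : ℤ) (b + 1) = insert (b + 1) (Finset.Icc 0 b) := by
      ext x; simp only [Finset.mem_Icc, Finset.mem_insert]; omega
    rw [h3, Finset.sum_insert (by simp)]
    rw [show b + 1 - 1 = b by ring] at h2
    linarith

/-- The total sum of the extremal difference function equals the degree:
`Σ_{n = 0}^{m + w + e} Δh n = d`. -/
theorem stmt_4 (s d m ε w v k δ e : ℤ)
    (hs : 4 ≤ s)
    (hd : d - 1 = s * m + ε) (hε0 : 0 ≤ ε) (hε1 : ε ≤ s - 1)
    (hsw : s - 1 = 3 * w + v) (hv : v = 0 ∨ v = 1 ∨ v = 2) (hw : 1 ≤ w)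
    (hcase0 : ε < w * (4 - v) → e = 0 ∧ ε = k * w + δ ∧ 0 ≤ δ ∧ δ < w)
    (hcase1 : w * (4 - v) ≤ ε → e = 1 ∧ ε + 3 - v = k * (w + 1) + δ ∧ 0 ≤ δ ∧ δ < w + 1)
    (hm : w < m) (Δh : ℤ → ℤ)
    (hΔ : ∀ n : ℤ,
      (n < 0 → Δh n = 0) ∧
      (0 ≤ n ∧ n ≤ w → Δh n = 3 * n + 1) ∧
      (w < n ∧ n ≤ m → Δh n = s) ∧
      (m < n ∧ n ≤ m + δ → Δh n = s + k - 3 * (n - m)) ∧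
      (m + δ < n ∧ n ≤ m + w + e → Δh n = s + k - 3 * (n - m) - 1) ∧
      (m + w + e < n → Δh n = 0)) :
    ∑ n ∈ Finset.Icc (0 : ℤ) (m + w + e), Δh n = d := by
  have hb : 0 ≤ δ ∧ δ ≤ w + e := by
    rcases lt_or_ge ε (w * (4 - v)) with h | h
    · have := hcase0 h; omega
    · have := hcase1 h; omega
  have h1 := tele_aux Δh (fun n => 3 * n * (n + 1) + 2 * n) (-1) w (by omega) (by omega) (by
    intro n h1 h2
    rw [(hΔ n).2.1 ⟨by omega, h2⟩]; ring)
  have h2 := tele_aux Δh (fun n => 2 * s * n) w m (by omega) (by omega) (by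
    intro n h1 h2
    rw [(hΔ n).2.2.1 ⟨h1, h2⟩]; ring)
  have h3 := tele_aux Δh (fun n => 2 * (s + k) * n - 3 * (n - m) * (n - m + 1))
    m (m + δ) (by omega) (by omega) (by
    intro n h1 h2
    rw [(hΔ n).2.2.2.1 ⟨h1, h2⟩]; ring)
  have h4 := tele_aux Δh (fun n => 2 * (s + k - 1) * n - 3 * (n - m) * (n - m + 1))
    (m + δ) (m + w + e) (by omega) (by omega) (by
    intro n h1 h2
    rw [(hΔ n).2.2.2.2.1 ⟨h1, h2⟩]; ring)
  rw [Finset.Icc_eq_empty (show ¬ ((0 : ℤ) ≤ -1) by norm_num), Finset.sum_empty] at h1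
  have key : 2 * ∑ n ∈ Finset.Icc (0 : ℤ) (m + w + e), Δh n = 2 * d := by
    rw [h4, h3, h2, h1]
    have hs' : s = 3 * w + v + 1 := by linarith
    rcases lt_or_ge ε (w * (4 - v)) with h | h
    · obtain ⟨he, h5, -, -⟩ := hcase0 h
      have hd' : d = s * m + (k * w + δ) + 1 := by linarith
      subst he
      rw [hd', hs']; ring
    · obtain ⟨he, h5, -, -⟩ := hcase1 h
      have hd' : d = s * m + (k * (w + 1) + δ - 3 + v) + 1 := by linarith
      subst he
      rw [hd', hs']; ring
  linarith
end

section
/- The value of the extremal difference function at m + 1 satisfies: Δh(m + 1) = s + k − 3 if δ ≥ 1, and Δh(m + 1) = s + k − 4 if δ = 0. In every case Δh(m + 1) ≤ s − 1, i.e. Δh(m + 1) < s. -/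
theorem aux_k (k X δ : ℤ) (hX : 1 ≤ X) (h0 : 0 ≤ δ) (h : k * X + δ ≤ 3 * X) :
    k ≤ 3 ∧ (1 ≤ δ → k ≤ 2) := by
  constructor
  · by_contra hk
    push Not at hk
    nlinarith
  · intro hd
    by_contra hk
    push Not at hk
    nlinarith

/-- `Δh (m + 1) = s + k - 3` if `δ ≥ 1` and `Δh (m + 1) = s + k - 4` if `δ = 0`;
in every case `Δh (m + 1) ≤ s - 1`, i.e. `Δh (m + 1) < s`. -/
theorem stmt_11 (s d m ε w v k δ e : ℤ)
    (hs : 4 ≤ s)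
    (hd : d - 1 = s * m + ε) (hε0 : 0 ≤ ε) (hε1 : ε ≤ s - 1)
    (hsw : s - 1 = 3 * w + v) (hv : v = 0 ∨ v = 1 ∨ v = 2) (hw : 1 ≤ w)
    (hcase0 : ε < w * (4 - v) → e = 0 ∧ ε = k * w + δ ∧ 0 ≤ δ ∧ δ < w)
    (hcase1 : w * (4 - v) ≤ ε → e = 1 ∧ ε + 3 - v = k * (w + 1) + δ ∧ 0 ≤ δ ∧ δ < w + 1)
    (hm : w < m) (Δh : ℤ → ℤ)
    (hΔ : ∀ n : ℤ,
      (n < 0 → Δh n = 0) ∧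
      (0 ≤ n ∧ n ≤ w → Δh n = 3 * n + 1) ∧
      (w < n ∧ n ≤ m → Δh n = s) ∧
      (m < n ∧ n ≤ m + δ → Δh n = s + k - 3 * (n - m)) ∧
      (m + δ < n ∧ n ≤ m + w + e → Δh n = s + k - 3 * (n - m) - 1) ∧
      (m + w + e < n → Δh n = 0)) :
    (1 ≤ δ → Δh (m + 1) = s + k - 3) ∧
    (δ = 0 → Δh (m + 1) = s + k - 4) ∧
    Δh (m + 1) ≤ s - 1 := by
  have key : 0 ≤ δ ∧ 0 ≤ e ∧ k ≤ 3 ∧ (1 ≤ δ → k ≤ 2) := by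
    by_cases hc : ε < w * (4 - v)
    · obtain ⟨he, h1, h2, h3⟩ := hcase0 hc
      have := aux_k k w δ hw h2 (by rcases hv with rfl | rfl | rfl <;> linarith)
      exact ⟨h2, by omega, this⟩
    · push Not at hc
      obtain ⟨he, h1, h2, h3⟩ := hcase1 hc
      have := aux_k k (w + 1) δ (by omega) h2 (by rcases hv with rfl | rfl | rfl <;> linarith)
      exact ⟨h2, by omega, this⟩
  obtain ⟨h0, he, hk3, hk2⟩ := key
  obtain ⟨-, -, -, h4, h5, -⟩ := hΔ (m + 1)
  have h6 : 1 ≤ δ → Δh (m + 1) = s + k - 3 := fun h => by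
    rw [h4 ⟨by omega, by omega⟩]; ring
  have h7 : δ = 0 → Δh (m + 1) = s + k - 4 := fun h => by
    rw [h5 ⟨by omega, by omega⟩]; ring
  refine ⟨h6, h7, ?_⟩
  rcases (by omega : 1 ≤ δ ∨ δ = 0) with h | h
  · have := h6 h
    have := hk2 h
    omega
  · have := h7 h
    omega
end
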